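/- arXiv:2303.12349 — 8 statements merged into one kernel-verified Lean document; each statement's English description precedes it below -/
import Mathlib

section
/- Let X be a nonempty connected compact metric space and Φ = {φ_1,…,φ_ℓ} a finite family of continuous self-maps of X such that the IFS (X,Φ⁺) is forward minimal and some map φ ∈ Φ has an attracting fixed point p. Then X is an attractor of the IFS (X,Φ⁺): for every nonempty compact subset B of X, d_H(F^j(B), X) → 0 as j → ∞. -/
open Metric Set Function Filter

/-- `f` belongs to the semigroup `Φ⁺` generated by `Φ` under composition:
`f` is a composition of a nonempty finite list of members of `Φ`. -/
def InSemigroup {X : Type*} (Φ : Set (X → X)) (f : X → X) : Prop :=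
  ∃ l : List (X → X), l ≠ [] ∧ (∀ g ∈ l, g ∈ Φ) ∧ f = l.foldr (· ∘ ·) id

/-- The Hutchinson operator associated with `Φ`: `F(Y)` is the closure of `⋃ φ ∈ Φ, φ(Y)`. -/
def Hutch {X : Type*} [TopologicalSpace X] (Φ : Set (X → X)) (Y : Set X) : Set X :=
  closure (⋃ φ ∈ Φ, φ '' Y)

/-- The IFS `(X, Φ⁺)` is forward minimal: `X` contains no nonempty proper closed subset
which is forward invariant under every member of `Φ`. -/
def ForwardMinimal {X : Type*} [TopologicalSpace X] (Φ : Set (X → X)) : Prop :=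
  ∀ A : Set X, A.Nonempty → IsClosed A → (∀ φ ∈ Φ, φ '' A ⊆ A) → A = Set.univ

/-- `p` is an attracting fixed point of `φ`: `φ p = p` and there is an open set `U ∋ p`
with `φ(closure U) ⊆ U` and `⋂ n, φ^n(U) = {p}`. -/
def AttractingFixedPoint {X : Type*} [TopologicalSpace X] (φ : X → X) (p : X) : Prop :=
  φ p = p ∧ ∃ U : Set X, IsOpen U ∧ p ∈ U ∧ φ '' closure U ⊆ U ∧ (⋂ n : ℕ, φ^[n] '' U) = {p}

/-- The points which some map of `Φ` sends into `V`. -/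
def preHutch {X : Type*} (Φ : Set (X → X)) (V : Set X) : Set X :=
  ⋃ φ ∈ Φ, φ ⁻¹' V

lemma mem_preHutch {X : Type*} {Φ : Set (X → X)} {V : Set X} {x : X} :
    x ∈ preHutch Φ V ↔ ∃ φ ∈ Φ, φ x ∈ V := by
  simp [preHutch]

lemma preHutch_mono {X : Type*} (Φ : Set (X → X)) : Monotone (preHutch Φ) := by
  intro V W hVW x hx
  obtain ⟨φ, hφ, h⟩ := mem_preHutch.1 hx
  exact mem_preHutch.2 ⟨φ, hφ, hVW h⟩

lemma isOpen_preHutch_iterate {X : Type*} [TopologicalSpace X] {Φ : Set (X → X)}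
    (hΦ : ∀ φ ∈ Φ, Continuous φ) {V : Set X} (hV : IsOpen V) (j : ℕ) :
    IsOpen ((preHutch Φ)^[j] V) := by
  induction j with
  | zero => exact hV
  | succ j ih =>
    rw [iterate_succ_apply']
    exact isOpen_biUnion fun φ hφ => ih.preimage (hΦ φ hφ)

lemma mem_preHutch_iterate_of_iterate_mem {X : Type*} {Φ : Set (X → X)} {φ : X → X}
    (hφ : φ ∈ Φ) {V : Set X} (n : ℕ) {x : X} (hx : φ^[n] x ∈ V) :
    x ∈ (preHutch Φ)^[n] V := by
  induction n generalizing x with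
  | zero => exact hx
  | succ n ih =>
    rw [iterate_succ_apply']
    exact mem_preHutch.2 ⟨φ, hφ, ih hx⟩

lemma inter_hutch_iterate_nonempty {X : Type*} [TopologicalSpace X] {Φ : Set (X → X)}
    {V : Set X} (j : ℕ) {B : Set X} {x : X} (hxB : x ∈ B)
    (hx : x ∈ (preHutch Φ)^[j] V) : (V ∩ (Hutch Φ)^[j] B).Nonempty := by
  induction j generalizing B x with
  | zero => exact ⟨x, hx, hxB⟩
  | succ j ih =>
    rw [iterate_succ_apply'] at hx
    rw [iterate_succ_apply]
    obtain ⟨φ, hφ, h⟩ := mem_preHutch.1 hx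
    exact ih (subset_closure (mem_biUnion hφ (mem_image_of_mem φ hxB))) h

/-- In a forward minimal IFS every point reaches every nonempty open set. -/
lemma ForwardMinimal.exists_mem_preHutch_iterate {X : Type*} [TopologicalSpace X]
    {Φ : Set (X → X)} (hmin : ForwardMinimal Φ) (hΦ : ∀ φ ∈ Φ, Continuous φ)
    {V : Set X} (hV : IsOpen V) (hne : V.Nonempty) (x : X) :
    ∃ j, x ∈ (preHutch Φ)^[j] V := by
  by_contra hx
  have hA : (⋃ j, (preHutch Φ)^[j] V)ᶜ = univ := by
    refine hmin _ ⟨x, by simpa using hx⟩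
      (isOpen_iUnion fun j => isOpen_preHutch_iterate hΦ hV j).isClosed_compl ?_
    rintro φ hφ _ ⟨y, hy, rfl⟩ hy'
    obtain ⟨j, hj⟩ := mem_iUnion.1 hy'
    refine hy (mem_iUnion.2 ⟨j + 1, ?_⟩)
    rw [iterate_succ_apply']
    exact mem_preHutch.2 ⟨φ, hφ, hj⟩
  obtain ⟨v, hv⟩ := hne
  have hv' : v ∈ (⋃ j, (preHutch Φ)^[j] V)ᶜ := hA ▸ mem_univ v
  exact hv' (mem_iUnion.2 ⟨0, hv⟩)

/-- The iterates of a trapping region shrinking to `p` are eventually contained in any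
neighbourhood of `p`. -/
lemma eventually_image_iterate_subset {X : Type*} [TopologicalSpace X] [CompactSpace X]
    [T2Space X] {φ : X → X} (hφ : Continuous φ) {p : X} {U : Set X}
    (hU : φ '' closure U ⊆ U) (hp : (⋂ n : ℕ, φ^[n] '' U) = {p})
    {W : Set X} (hW : IsOpen W) (hpW : p ∈ W) :
    ∀ᶠ n in atTop, φ^[n] '' U ⊆ W := by
  have hstep (n : ℕ) : φ^[n + 1] '' closure U ⊆ φ^[n] '' U := by
    rw [iterate_succ, image_comp]
    exact image_mono hU
  have hanti : Antitone fun n : ℕ => φ^[n] '' closure U :=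
    antitone_nat_of_succ_le fun n => (hstep n).trans (image_mono subset_closure)
  have hcpt (n : ℕ) : IsCompact (φ^[n] '' closure U) :=
    isClosed_closure.isCompact.image (hφ.iterate n)
  have hsub : (⋂ n : ℕ, φ^[n] '' closure U) ⊆ W := by
    intro x hx
    have hxp : x ∈ ⋂ n : ℕ, φ^[n] '' U :=
      mem_iInter.2 fun n => hstep n (mem_iInter.1 hx (n + 1))
    rw [hp] at hxp
    exact (mem_singleton_iff.1 hxp) ▸ hpW
  obtain ⟨N, hN⟩ := exists_subset_nhds_of_isCompact hanti.directed_ge hcpt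
    fun x hx => hW.mem_nhds (hsub hx)
  filter_upwards [eventually_ge_atTop N] with n hn
  exact ((image_mono subset_closure).trans (hanti hn)).trans hN

/-- Under forward minimality and the existence of an attracting fixed point, the iterates of
the Hutchinson operator eventually meet every nonempty open set. -/
lemma ForwardMinimal.eventually_inter_hutch_iterate_nonempty {X : Type*} [TopologicalSpace X]
    [CompactSpace X] [T2Space X] {Φ : Set (X → X)} (hmin : ForwardMinimal Φ)
    (hΦ : ∀ φ ∈ Φ, Continuous φ) {φ : X → X} (hφ : φ ∈ Φ) {p : X}
    (hp : AttractingFixedPoint φ p) {B : Set X} (hB : B.Nonempty)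
    {V : Set X} (hV : IsOpen V) (hne : V.Nonempty) :
    ∀ᶠ j in atTop, (V ∩ (Hutch Φ)^[j] B).Nonempty := by
  obtain ⟨-, U, hUo, hpU, hU, hUp⟩ := hp
  obtain ⟨b, hb⟩ := hB
  obtain ⟨m, hm⟩ := hmin.exists_mem_preHutch_iterate hΦ hUo ⟨p, hpU⟩ b
  obtain ⟨k, hk⟩ := hmin.exists_mem_preHutch_iterate hΦ hV hne p
  obtain ⟨N, hN⟩ := eventually_atTop.1 (eventually_image_iterate_subset (hΦ φ hφ) hU hUp
    (isOpen_preHutch_iterate hΦ hV k) hk)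
  filter_upwards [eventually_ge_atTop (m + (N + k))] with j hj
  obtain ⟨n, rfl⟩ := Nat.exists_eq_add_of_le hj
  refine inter_hutch_iterate_nonempty _ hb ?_
  rw [show m + (N + k) + n = m + ((N + n) + k) by ring, iterate_add_apply, iterate_add_apply]
  refine (preHutch_mono Φ).iterate m (fun x hx => ?_) hm
  exact mem_preHutch_iterate_of_iterate_mem hφ _
    (hN (N + n) (Nat.le_add_right N n) (mem_image_of_mem _ hx))

/-- If `X` is a nonempty connected compact metric space, `Φ` a finite family of
continuous self-maps such that the IFS `(X, Φ⁺)` is forward minimal and some `φ ∈ Φ` has an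
attracting fixed point `p`, then `X` is an attractor of the IFS: for every nonempty compact
`B ⊆ X` one has `d_H(F^j(B), X) → 0` as `j → ∞`. -/
theorem stmt0 {X : Type*} [MetricSpace X] [CompactSpace X] [ConnectedSpace X] [Nonempty X]
    (Φ : Set (X → X)) (hΦfin : Φ.Finite) (hΦne : Φ.Nonempty)
    (hΦcont : ∀ φ ∈ Φ, Continuous φ)
    (hmin : ForwardMinimal Φ)
    (φ : X → X) (hφ : φ ∈ Φ) (p : X) (hp : AttractingFixedPoint φ p) :
    ∀ B : Set X, B.Nonempty → IsCompact B →
      Filter.Tendsto (fun j : ℕ => hausdorffDist ((Hutch Φ)^[j] B) (Set.univ : Set X))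
        Filter.atTop (nhds 0) := by
  intro B hB _
  rw [Metric.tendsto_atTop']
  intro ε hε
  obtain ⟨t, -, ht, hcov⟩ := finite_cover_balls_of_compact (isCompact_univ (X := X))
    (show (0 : ℝ) < ε / 4 by positivity)
  have hev : ∀ᶠ j in atTop, ∀ c ∈ t, (ball c (ε / 4) ∩ (Hutch Φ)^[j] B).Nonempty :=
    (eventually_all_finite ht).2 fun c _ =>
      hmin.eventually_inter_hutch_iterate_nonempty hΦcont hφ hp hB isOpen_ball
        ⟨c, mem_ball_self (by positivity)⟩
  obtain ⟨N, hN⟩ := eventually_atTop.1 hev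
  refine ⟨N, fun j hj => ?_⟩
  have hle : hausdorffDist ((Hutch Φ)^[j] B) univ ≤ ε / 2 := by
    refine hausdorffDist_le_of_mem_dist (by positivity)
      (fun x _ => ⟨x, mem_univ x, by rw [dist_self]; positivity⟩) fun x hx => ?_
    obtain ⟨c, hc, hxc⟩ := mem_iUnion₂.1 (hcov hx)
    obtain ⟨y, hyc, hy⟩ := hN j hj.le c hc
    refine ⟨y, hy, ?_⟩
    rw [mem_ball] at hxc hyc
    linarith [dist_triangle_right x y c]
  rw [Real.dist_eq, sub_zero, abs_of_nonneg hausdorffDist_nonneg]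
  linarith
end

section
/- Let X be a nonempty connected compact metric space and Φ = {φ_1,…,φ_ℓ} a finite family of continuous self-maps of X such that the IFS (X,Φ⁺) is forward minimal and some map φ ∈ Φ has an attracting fixed point p. Then the system (K(X), F) is equicontinuous: for every D ∈ K(X) and every ε > 0 there exists δ > 0 such that every D' ∈ K(X) with d_H(D, D') < δ satisfies sup_{i≥0} d_H(F^i(D), F^i(D')) < ε. -/
open Metric Set Function Filter

/-- The set of compositions of exactly `n` members of `Φ`. -/
def wordMaps {X : Type*} (Φ : Set (X → X)) : ℕ → Set (X → X)
  | 0 => {id}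
  | n + 1 => image2 (· ∘ ·) Φ (wordMaps Φ n)

section WordMaps

variable {X : Type*} {Φ : Set (X → X)}

theorem wordMaps_finite (hΦ : Φ.Finite) (n : ℕ) : (wordMaps Φ n).Finite := by
  induction n with
  | zero => exact finite_singleton _
  | succ n ih => exact hΦ.image2 _ ih

theorem continuous_of_mem_wordMaps [TopologicalSpace X] (hΦ : ∀ φ ∈ Φ, Continuous φ) {n : ℕ}
    {w : X → X} (hw : w ∈ wordMaps Φ n) : Continuous w := by
  induction n generalizing w with
  | zero => rw [mem_singleton_iff.1 hw]; exact continuous_id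
  | succ n ih =>
    obtain ⟨φ, hφ, v, hv, rfl⟩ := hw
    exact (hΦ φ hφ).comp (ih hv)

theorem comp_mem_wordMaps {m n : ℕ} {u v : X → X} (hu : u ∈ wordMaps Φ m)
    (hv : v ∈ wordMaps Φ n) : u ∘ v ∈ wordMaps Φ (m + n) := by
  induction m generalizing u with
  | zero => rw [mem_singleton_iff.1 hu]; simpa using hv
  | succ m ih =>
    obtain ⟨φ, hφ, w, hw, rfl⟩ := hu
    rw [Nat.succ_add]
    exact ⟨φ, hφ, w ∘ v, ih hw, rfl⟩

theorem iterate_mem_wordMaps {φ : X → X} (hφ : φ ∈ Φ) (n : ℕ) : φ^[n] ∈ wordMaps Φ n := by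
  induction n with
  | zero => exact mem_singleton _
  | succ n ih => exact ⟨φ, hφ, φ^[n], ih, (iterate_succ' φ n).symm⟩

theorem hutch_iterate [TopologicalSpace X] [T2Space X] (hfin : Φ.Finite)
    (hcont : ∀ φ ∈ Φ, Continuous φ) {D : Set X} (hD : IsCompact D) (n : ℕ) :
    (Hutch Φ)^[n] D = ⋃ w ∈ wordMaps Φ n, w '' D := by
  induction n with
  | zero => simp [wordMaps]
  | succ n ih =>
    have key : (⋃ φ ∈ Φ, φ '' ⋃ w ∈ wordMaps Φ n, w '' D) =
        ⋃ w ∈ wordMaps Φ (n + 1), w '' D := by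
      simp only [wordMaps, biUnion_image2, image_iUnion, image_comp]
    rw [iterate_succ_apply', ih, Hutch, key]
    exact ((wordMaps_finite hfin _).isCompact_biUnion fun w hw =>
      hD.image (continuous_of_mem_wordMaps hcont hw)).isClosed.closure_eq

theorem ForwardMinimal.dense_orbit [TopologicalSpace X] (hmin : ForwardMinimal Φ)
    (hcont : ∀ φ ∈ Φ, Continuous φ) (x : X) :
    Dense {y | ∃ n, ∃ w ∈ wordMaps Φ n, w x = y} := by
  rw [dense_iff_closure_eq]
  refine hmin _ ⟨x, subset_closure ⟨0, id, mem_singleton _, rfl⟩⟩ isClosed_closure ?_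
  intro φ hφ
  refine (image_closure_subset_closure_image (hcont φ hφ)).trans (closure_mono ?_)
  rintro _ ⟨_, ⟨n, w, hw, rfl⟩, rfl⟩
  exact ⟨n + 1, φ ∘ w, ⟨φ, hφ, w, hw, rfl⟩, rfl⟩

theorem ForwardMinimal.exists_bounded_hitting [TopologicalSpace X] [CompactSpace X]
    (hmin : ForwardMinimal Φ) (hcont : ∀ φ ∈ Φ, Continuous φ) {U : Set X} (hU : IsOpen U)
    (hUne : U.Nonempty) : ∃ L, ∀ x, ∃ n ≤ L, ∃ w ∈ wordMaps Φ n, w x ∈ U := by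
  have hmono : Monotone fun L : ℕ => {x | ∃ n ≤ L, ∃ w ∈ wordMaps Φ n, w x ∈ U} :=
    fun a b hab x ⟨n, hn, h⟩ => ⟨n, hn.trans hab, h⟩
  suffices h : ∃ L, univ ⊆ {x | ∃ n ≤ L, ∃ w ∈ wordMaps Φ n, w x ∈ U} by
    obtain ⟨L, hL⟩ := h
    exact ⟨L, fun x => hL (mem_univ x)⟩
  refine isCompact_univ.elim_directed_cover _ ?_ ?_ hmono.directed_le
  · intro L
    simp only [isOpen_iff_mem_nhds]
    rintro x ⟨n, hn, w, hw, hx⟩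
    filter_upwards [(continuous_of_mem_wordMaps hcont hw).continuousAt (hU.mem_nhds hx)] with y hy
    exact ⟨n, hn, w, hw, hy⟩
  · intro x _
    obtain ⟨_, hy, n, w, hw, rfl⟩ := (hmin.dense_orbit hcont x).inter_open_nonempty U hU hUne
    exact mem_iUnion.2 ⟨n, n, le_rfl, w, hw, hy⟩

theorem ForwardMinimal.exists_dense_of_isFixedPt [PseudoMetricSpace X] [CompactSpace X]
    (hmin : ForwardMinimal Φ) (hcont : ∀ φ ∈ Φ, Continuous φ) {φ : X → X} (hφ : φ ∈ Φ) {p : X}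
    (hp : φ p = p) {ε : ℝ} (hε : 0 < ε) : ∃ N, ∀ y, ∃ w ∈ wordMaps Φ N, dist (w p) y < ε := by
  have hmono : Monotone fun N : ℕ => {y | ∃ w ∈ wordMaps Φ N, dist (w p) y < ε} := by
    refine monotone_nat_of_le_succ ?_
    rintro N y ⟨w, hw, hy⟩
    exact ⟨w ∘ φ, comp_mem_wordMaps hw (iterate_mem_wordMaps hφ 1), by simpa [hp] using hy⟩
  suffices h : ∃ N, univ ⊆ {y | ∃ w ∈ wordMaps Φ N, dist (w p) y < ε} by
    obtain ⟨N, hN⟩ := h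
    exact ⟨N, fun y => hN (mem_univ y)⟩
  refine isCompact_univ.elim_directed_cover _ ?_ ?_ hmono.directed_le
  · intro N
    simp only [isOpen_iff_mem_nhds]
    rintro y ⟨w, hw, hy⟩
    filter_upwards [(isOpen_lt (continuous_const.dist continuous_id) continuous_const).mem_nhds hy]
      with z hz
    exact ⟨w, hw, hz⟩
  · intro y _
    obtain ⟨_, ⟨n, w, hw, rfl⟩, hy⟩ := (hmin.dense_orbit hcont p).exists_dist_lt y hε
    exact mem_iUnion.2 ⟨n, w, hw, by rwa [dist_comm]⟩

end WordMaps

/-- Some neighbourhood of an attracting fixed point is uniformly attracted to it. -/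
theorem AttractingFixedPoint.exists_uniform_basin {X : Type*} [TopologicalSpace X] [T2Space X]
    [CompactSpace X] {φ : X → X} {p : X} (hp : AttractingFixedPoint φ p) (hφ : Continuous φ) :
    ∃ U, IsOpen U ∧ p ∈ U ∧
      ∀ V, IsOpen V → p ∈ V → ∃ k₀, ∀ k ≥ k₀, ∀ x ∈ U, φ^[k] x ∈ V := by
  obtain ⟨-, U, hU, hpU, hsub, hInter⟩ := hp
  refine ⟨U, hU, hpU, fun V hV hpV => ?_⟩
  have hanti : Antitone fun n : ℕ => φ^[n] '' closure U := by
    refine antitone_nat_of_succ_le fun n => ?_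
    rw [iterate_succ, image_comp]
    exact image_mono (hsub.trans subset_closure)
  obtain ⟨k₀, hk₀⟩ := exists_subset_nhds_of_isCompact' (V := fun n : ℕ => φ^[n] '' closure U)
    hanti.directed_ge
    (fun n => isClosed_closure.isCompact.image (hφ.iterate n))
    (fun n => (isClosed_closure.isCompact.image (hφ.iterate n)).isClosed) (U := V) (by
      intro x hx
      have hxp : x ∈ ⋂ n : ℕ, φ^[n] '' U := by
        refine mem_iInter.2 fun n => ?_
        have := mem_iInter.1 hx (n + 1)
        rw [iterate_succ, image_comp] at this
        exact image_mono hsub this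
      rw [hInter, mem_singleton_iff] at hxp
      exact hxp ▸ hV.mem_nhds hpV)
  exact ⟨k₀, fun k hk x hx => hk₀ (hanti hk ⟨x, subset_closure hx, rfl⟩)⟩

/-- Under forward minimality, an attracting fixed point makes the set of images of a point under
words of length `n` uniformly dense for all large `n`. -/
theorem ForwardMinimal.exists_uniformly_dense {X : Type*} [MetricSpace X] [CompactSpace X]
    {Φ : Set (X → X)} (hmin : ForwardMinimal Φ) (hfin : Φ.Finite)
    (hcont : ∀ φ ∈ Φ, Continuous φ) {φ : X → X} (hφ : φ ∈ Φ) {p : X}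
    (hp : AttractingFixedPoint φ p) {ε : ℝ} (hε : 0 < ε) :
    ∃ M, ∀ n ≥ M, ∀ x y, ∃ w ∈ wordMaps Φ n, dist (w x) y < ε := by
  obtain ⟨U, hU, hpU, hbasin⟩ := hp.exists_uniform_basin (hcont φ hφ)
  obtain ⟨N, hN⟩ := hmin.exists_dense_of_isFixedPt hcont hφ hp.1 (half_pos hε)
  obtain ⟨L, hL⟩ := hmin.exists_bounded_hitting hcont hU ⟨p, hpU⟩
  obtain ⟨k₀, hk₀⟩ := hbasin (⋂ w ∈ wordMaps Φ N, {z | dist (w z) (w p) < ε / 2})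
    ((wordMaps_finite hfin N).isOpen_biInter fun w hw =>
      isOpen_lt ((continuous_of_mem_wordMaps hcont hw).dist continuous_const) continuous_const)
    (by simp [hε])
  refine ⟨L + k₀ + N, fun n hn x y => ?_⟩
  obtain ⟨m, hm, v, hv, hvx⟩ := hL x
  obtain ⟨u, hu, huy⟩ := hN y
  obtain ⟨k, rfl⟩ : ∃ k, n = N + (k + m) := ⟨n - N - m, by omega⟩
  refine ⟨u ∘ φ^[k] ∘ v,
    comp_mem_wordMaps hu (comp_mem_wordMaps (iterate_mem_wordMaps hφ k) hv), ?_⟩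
  have hclose := mem_iInter₂.1 (hk₀ k (by omega) (v x) hvx) u hu
  calc dist (u (φ^[k] (v x))) y ≤ dist (u (φ^[k] (v x))) (u p) + dist (u p) y :=
        dist_triangle _ _ _
    _ < ε / 2 + ε / 2 := add_lt_add hclose huy
    _ = ε := add_halves ε

/-- A finite family of continuous self-maps of a compact space is uniformly equicontinuous. -/
theorem Set.Finite.exists_dist_lt_of_continuous {X : Type*} [PseudoMetricSpace X] [CompactSpace X]
    {S : Set (X → X)} (hS : S.Finite) (hcont : ∀ w ∈ S, Continuous w) {ε : ℝ} (hε : 0 < ε) :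
    ∃ δ > 0, ∀ w ∈ S, ∀ x y, dist x y < δ → dist (w x) (w y) < ε := by
  induction S, hS using Set.Finite.induction_on with
  | empty => exact ⟨1, one_pos, by simp⟩
  | @insert a S _ _ ih =>
    obtain ⟨δ₁, hδ₁, h₁⟩ := ih fun w hw => hcont w (mem_insert_of_mem _ hw)
    obtain ⟨δ₂, hδ₂, h₂⟩ := Metric.uniformContinuous_iff.1
      (CompactSpace.uniformContinuous_of_continuous (hcont a (mem_insert _ _))) ε hε
    refine ⟨min δ₁ δ₂, lt_min hδ₁ hδ₂, ?_⟩
    rintro w (rfl | hw) x y hxy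
    · exact h₂ (hxy.trans_le (min_le_right _ _))
    · exact h₁ w hw x y (hxy.trans_le (min_le_left _ _))

/-- If `X` is a nonempty connected compact metric space, `Φ` a finite family of
continuous self-maps such that the IFS `(X, Φ⁺)` is forward minimal and some `φ ∈ Φ` has an
attracting fixed point `p`, then the system `(K(X), F)` is equicontinuous. -/
theorem stmt1 {X : Type*} [MetricSpace X] [CompactSpace X] [ConnectedSpace X] [Nonempty X]
    (Φ : Set (X → X)) (hΦfin : Φ.Finite) (hΦne : Φ.Nonempty)
    (hΦcont : ∀ φ ∈ Φ, Continuous φ)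
    (hmin : ForwardMinimal Φ)
    (φ : X → X) (hφ : φ ∈ Φ) (p : X) (hp : AttractingFixedPoint φ p) :
    ∀ D : Set X, D.Nonempty → IsCompact D → ∀ ε > (0 : ℝ), ∃ δ > (0 : ℝ),
      ∀ D' : Set X, D'.Nonempty → IsCompact D' → hausdorffDist D D' < δ →
        ∀ i : ℕ, hausdorffDist ((Hutch Φ)^[i] D) ((Hutch Φ)^[i] D') < ε := by
  intro D hDne hD ε hε
  obtain ⟨M, hM⟩ := hmin.exists_uniformly_dense hΦfin hΦcont hφ hp (half_pos hε)
  obtain ⟨δ, hδ, hδM⟩ := Set.Finite.exists_dist_lt_of_continuous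
    (S := ⋃ i ∈ Iio M, wordMaps Φ i)
    ((finite_Iio M).biUnion fun i _ => wordMaps_finite hΦfin i)
    (by
      intro w hw
      obtain ⟨i, -, hwi⟩ := mem_iUnion₂.1 hw
      exact continuous_of_mem_wordMaps hΦcont hwi) (half_pos hε)
  have near : ∀ A B : Set X, A.Nonempty → B.Nonempty → IsCompact A → IsCompact B →
      hausdorffDist A B < δ → ∀ i, ∀ x ∈ ⋃ w ∈ wordMaps Φ i, w '' A,
        ∃ y ∈ ⋃ w ∈ wordMaps Φ i, w '' B, dist x y ≤ ε / 2 := by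
    intro A B hA hB hAc hBc hAB i x hx
    rcases lt_or_ge i M with hi | hi
    · obtain ⟨w, hw, a, ha, rfl⟩ := mem_iUnion₂.1 hx
      obtain ⟨b, hb, hab⟩ := exists_dist_lt_of_hausdorffDist_lt ha hAB
        (hausdorffEDist_ne_top_of_nonempty_of_bounded hA hB hAc.isBounded hBc.isBounded)
      exact ⟨w b, mem_iUnion₂.2 ⟨w, hw, b, hb, rfl⟩,
        (hδM w (mem_iUnion₂.2 ⟨i, hi, hw⟩) a b hab).le⟩
    · obtain ⟨b, hb⟩ := hB
      obtain ⟨w, hw, hwx⟩ := hM i hi b x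
      exact ⟨w b, mem_iUnion₂.2 ⟨w, hw, b, hb, rfl⟩, by rw [dist_comm]; exact hwx.le⟩
  refine ⟨δ, hδ, fun D' hD'ne hD' hDD' i => ?_⟩
  rw [hutch_iterate hΦfin hΦcont hD, hutch_iterate hΦfin hΦcont hD']
  refine (hausdorffDist_le_of_mem_dist (half_pos hε).le (near D D' hDne hD'ne hD hD' hDD' i)
    (near D' D hD'ne hDne hD' hD ?_ i)).trans_lt (half_lt_self hε)
  rwa [hausdorffDist_comm]
end

section
/- Let X be a nonempty compact metric space and Φ = {φ_1,…,φ_ℓ} a finite family of continuous self-maps of X. Suppose X is an attractor of the IFS (X,Φ⁺) and the system (K(X), F) is equicontinuous. Then F : K(X) → K(X) has the shadowing property: for every ε > 0 there exists δ > 0 such that every sequence {X_i}_{i≥0} in K(X) with d_H(X_{i+1}, F(X_i)) < δ for all i admits Y ∈ K(X) with d_H(X_i, F^i(Y)) < ε for all i ≥ 0. -/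
open Metric Set Function Filter

/-- Along a `c`-pseudo-orbit of a map all of whose iterates send `c`-close points to `η`-close
points, `j` steps of the pseudo-orbit stay within `j * η` of the true orbit. -/
theorem dist_iterate_pseudoOrbit_le {K : Type*} [PseudoMetricSpace K] {F : K → K} {c η : ℝ}
    (h : ∀ x y, dist x y < c → ∀ n : ℕ, dist (F^[n] x) (F^[n] y) < η)
    {x : ℕ → K} (hx : ∀ i, dist (x (i + 1)) (F (x i)) < c) (j i : ℕ) :
    dist (x (i + j)) (F^[j] (x i)) ≤ j * η := by
  induction j generalizing i with
  | zero => simp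
  | succ j ih =>
    have h₁ := ih (i + 1)
    have h₂ := h _ _ (hx i) j
    rw [← Function.iterate_succ_apply] at h₂
    have h₃ := dist_triangle (x (i + 1 + j)) (F^[j] (x (i + 1))) (F^[j + 1] (x i))
    rw [show i + (j + 1) = i + 1 + j by omega]
    push_cast
    linarith

/-- A self-map of a compact metric space whose iterates are equicontinuous and converge
pointwise to a constant has the shadowing property. -/
theorem shadowing_of_equicontinuous_of_tendsto {K : Type*} [MetricSpace K] [CompactSpace K]
    {F : K → K} {u : K} (hF : Equicontinuous fun n : ℕ => F^[n])
    (hu : ∀ x, Tendsto (fun n : ℕ => F^[n] x) atTop (nhds u)) {ε : ℝ} (hε : 0 < ε) :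
    ∃ δ > 0, ∀ x : ℕ → K, (∀ i, dist (x (i + 1)) (F (x i)) < δ) →
      ∀ i, dist (x i) (F^[i] (x 0)) < ε := by
  have hunif : TendstoUniformly (fun n : ℕ => F^[n]) (fun _ => u) atTop :=
    UniformFun.tendsto_iff_tendstoUniformly.1
      ((hF.tendsto_uniformFun_iff_pi atTop fun _ => u).2 (tendsto_pi_nhds.2 hu))
  obtain ⟨N, hN⟩ := eventually_atTop.1 (Metric.tendstoUniformly_iff.1 hunif (ε / 4) (by positivity))
  have hη : 0 < ε / (4 * (N + 1)) := by positivity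
  obtain ⟨δ, hδ, h⟩ := Metric.uniformEquicontinuous_iff.1
    (CompactSpace.uniformEquicontinuous_of_equicontinuous hF) _ hη
  refine ⟨δ, hδ, fun x hx i => ?_⟩
  have key (j i : ℕ) (hj : j ≤ N) : dist (x (i + j)) (F^[j] (x i)) ≤ ε / 4 := by
    refine (dist_iterate_pseudoOrbit_le h hx j i).trans ?_
    have hj' : (j : ℝ) ≤ N + 1 := by exact_mod_cast hj.trans N.le_succ
    calc (j : ℝ) * (ε / (4 * (N + 1))) ≤ (N + 1) * (ε / (4 * (N + 1))) := by gcongr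
      _ = ε / 4 := by field_simp
  rcases le_total i N with hi | hi
  · have := key i 0 hi
    rw [zero_add] at this
    linarith
  · have h₁ := key N (i - N) le_rfl
    rw [Nat.sub_add_cancel hi] at h₁
    have h₂ := hN N le_rfl (x (i - N))
    have h₃ := hN i hi (x 0)
    rw [dist_comm] at h₂
    have h₄ := dist_triangle4 (x i) (F^[N] (x (i - N))) u (F^[i] (x 0))
    linarith

open TopologicalSpace in
/-- The Hutchinson operator on the nonempty compact subsets of a compact space. -/
def hutchNonemptyCompacts {X : Type*} [TopologicalSpace X] [CompactSpace X] {Φ : Set (X → X)}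
    (hΦ : Φ.Nonempty) (K : NonemptyCompacts X) : NonemptyCompacts X where
  carrier := Hutch Φ K
  isCompact' := isClosed_closure.isCompact
  nonempty' := by
    obtain ⟨φ, hφ⟩ := hΦ
    obtain ⟨x, hx⟩ := K.nonempty
    exact ⟨φ x, subset_closure (mem_biUnion hφ (mem_image_of_mem φ hx))⟩

theorem coe_iterate_hutchNonemptyCompacts {X : Type*} [TopologicalSpace X] [CompactSpace X]
    {Φ : Set (X → X)} (hΦ : Φ.Nonempty) (n : ℕ) (K : TopologicalSpace.NonemptyCompacts X) :
    (((hutchNonemptyCompacts hΦ)^[n] K : TopologicalSpace.NonemptyCompacts X) : Set X) =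
      (Hutch Φ)^[n] K :=
  Function.Semiconj.iterate_right
    (f := ((↑) : TopologicalSpace.NonemptyCompacts X → Set X)) (fun _ => rfl) n K

/-- If `X` is a nonempty compact metric space, `Φ` a finite family of continuous
self-maps, `X` is an attractor of the IFS `(X, Φ⁺)` and the system `(K(X), F)` is equicontinuous,
then the Hutchinson operator `F` has the shadowing property on `K(X)`. -/
theorem stmt2 {X : Type*} [MetricSpace X] [CompactSpace X] [Nonempty X]
    (Φ : Set (X → X)) (hΦfin : Φ.Finite) (hΦne : Φ.Nonempty)
    (hΦcont : ∀ φ ∈ Φ, Continuous φ)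
    (hattr : ∀ B : Set X, B.Nonempty → IsCompact B →
      Filter.Tendsto (fun j : ℕ => hausdorffDist ((Hutch Φ)^[j] B) (Set.univ : Set X))
        Filter.atTop (nhds 0))
    (hequi : ∀ D : Set X, D.Nonempty → IsCompact D → ∀ ε > (0 : ℝ), ∃ δ > (0 : ℝ),
      ∀ D' : Set X, D'.Nonempty → IsCompact D' → hausdorffDist D D' < δ →
        ∀ i : ℕ, hausdorffDist ((Hutch Φ)^[i] D) ((Hutch Φ)^[i] D') < ε) :
    ∀ ε > (0 : ℝ), ∃ δ > (0 : ℝ), ∀ Xs : ℕ → Set X,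
      (∀ i, (Xs i).Nonempty) → (∀ i, IsCompact (Xs i)) →
      (∀ i, hausdorffDist (Xs (i + 1)) (Hutch Φ (Xs i)) < δ) →
      ∃ Y : Set X, Y.Nonempty ∧ IsCompact Y ∧
        ∀ i : ℕ, hausdorffDist (Xs i) ((Hutch Φ)^[i] Y) < ε := by
  intro ε hε
  have hequi' : Equicontinuous fun n : ℕ => (hutchNonemptyCompacts hΦne)^[n] := fun D => by
    rw [Metric.equicontinuousAt_iff]
    intro ε hε
    obtain ⟨δ, hδ, h⟩ := hequi D D.nonempty D.isCompact ε hε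
    refine ⟨δ, hδ, fun D' hD' n => ?_⟩
    rw [dist_comm, NonemptyCompacts.dist_eq] at hD'
    simpa only [NonemptyCompacts.dist_eq, coe_iterate_hutchNonemptyCompacts] using
      h D' D'.nonempty D'.isCompact hD' n
  have hattr' (B : TopologicalSpace.NonemptyCompacts X) :
      Tendsto (fun n : ℕ => (hutchNonemptyCompacts hΦne)^[n] B) atTop (nhds ⊤) := by
    rw [tendsto_iff_dist_tendsto_zero]
    simpa only [NonemptyCompacts.dist_eq, coe_iterate_hutchNonemptyCompacts,
      TopologicalSpace.NonemptyCompacts.coe_top] using hattr B B.nonempty B.isCompact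
  obtain ⟨δ, hδ, h⟩ := shadowing_of_equicontinuous_of_tendsto hequi' hattr' hε
  refine ⟨δ, hδ, fun Xs hne hcpt hXs => ⟨Xs 0, hne 0, hcpt 0, fun i => ?_⟩⟩
  simpa only [NonemptyCompacts.dist_eq, coe_iterate_hutchNonemptyCompacts,
    TopologicalSpace.NonemptyCompacts.coe_mk, TopologicalSpace.Compacts.coe_mk] using
    h (fun i => ⟨⟨Xs i, hcpt i⟩, hne i⟩) hXs i
end

section
/- Let X be a nonempty compact metric space and Φ = {φ_1,…,φ_ℓ} a finite family of continuous self-maps of X. If x ∈ X is an equicontinuous point of the IFS (X,Φ⁺), i.e. for every ε > 0 there is δ > 0 such that d(x,y) < δ implies d(φ(x), φ(y)) < ε for every φ ∈ Φ⁺, then the singleton {x} is an equicontinuous point of the system (K(X), F): for every ε > 0 there is δ > 0 such that every D ∈ K(X) with d_H({x}, D) < δ satisfies sup_{i≥0} d_H(F^i({x}), F^i(D)) < ε. -/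
open Metric Set Function Filter

/-- The points `f y`, where `y ∈ D` and `f` is a composition of `n` members of `Φ`. -/
def wordImage {X : Type*} (Φ : Set (X → X)) (n : ℕ) (D : Set X) : Set X :=
  {z | ∃ l : List (X → X), l.length = n ∧ (∀ g ∈ l, g ∈ Φ) ∧ ∃ y ∈ D, l.foldr (· ∘ ·) id y = z}

lemma wordImage_zero {X : Type*} (Φ : Set (X → X)) (D : Set X) : wordImage Φ 0 D = D := by
  ext z
  constructor
  · rintro ⟨l, hl, -, y, hy, rfl⟩
    obtain rfl := List.length_eq_zero_iff.1 hl
    exact hy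
  · exact fun hz => ⟨[], rfl, by simp, z, hz, rfl⟩

lemma wordImage_succ {X : Type*} (Φ : Set (X → X)) (n : ℕ) (D : Set X) :
    wordImage Φ (n + 1) D = ⋃ φ ∈ Φ, φ '' wordImage Φ n D := by
  ext z
  simp only [mem_iUnion, exists_prop]
  constructor
  · rintro ⟨_ | ⟨g, l⟩, hl, hΦ, y, hy, rfl⟩
    · simp at hl
    · exact ⟨g, hΦ g (by simp), _,
        ⟨l, by simpa using hl, fun h hh => hΦ h (by simp [hh]), y, hy, rfl⟩, rfl⟩
  · rintro ⟨φ, hφ, _, ⟨l, hl, hΦ, y, hy, rfl⟩, rfl⟩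
    exact ⟨φ :: l, by simp [hl], by simpa using ⟨hφ, hΦ⟩, y, hy, rfl⟩

lemma Hutch_closure {X : Type*} [TopologicalSpace X] {Φ : Set (X → X)}
    (hΦ : ∀ φ ∈ Φ, Continuous φ) (A : Set X) : Hutch Φ (closure A) = Hutch Φ A := by
  refine Subset.antisymm (closure_minimal (iUnion₂_subset fun φ hφ => ?_) isClosed_closure)
    (closure_mono (iUnion₂_mono fun φ _ => image_mono subset_closure))
  exact (image_closure_subset_closure_image (hΦ φ hφ)).trans
    (closure_mono (subset_biUnion_of_mem (u := fun φ => φ '' A) hφ))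

lemma closure_iterate_Hutch {X : Type*} [TopologicalSpace X] {Φ : Set (X → X)}
    (hΦ : ∀ φ ∈ Φ, Continuous φ) (D : Set X) (n : ℕ) :
    closure ((Hutch Φ)^[n] D) = closure (wordImage Φ n D) := by
  induction n with
  | zero => rw [wordImage_zero, iterate_zero_apply]
  | succ n ih =>
    rw [iterate_succ_apply', ← Hutch_closure hΦ, ih, Hutch_closure hΦ, wordImage_succ, Hutch,
      closure_closure]

/-- If `x` is an equicontinuous point of the IFS `(X, Φ⁺)`, then the singleton
`{x}` is an equicontinuous point of the system `(K(X), F)`. -/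
theorem stmt3 {X : Type*} [MetricSpace X] [CompactSpace X] [Nonempty X]
    (Φ : Set (X → X)) (hΦfin : Φ.Finite) (hΦne : Φ.Nonempty)
    (hΦcont : ∀ φ ∈ Φ, Continuous φ)
    (x : X)
    (hx : ∀ ε > (0 : ℝ), ∃ δ > (0 : ℝ), ∀ y : X, dist x y < δ →
      ∀ f : X → X, InSemigroup Φ f → dist (f x) (f y) < ε) :
    ∀ ε > (0 : ℝ), ∃ δ > (0 : ℝ), ∀ D : Set X, D.Nonempty → IsCompact D →
      hausdorffDist ({x} : Set X) D < δ →
      ∀ i : ℕ, hausdorffDist ((Hutch Φ)^[i] {x}) ((Hutch Φ)^[i] D) < ε := by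
  intro ε hε
  obtain ⟨δ, hδ, hδx⟩ := hx (ε / 2) (half_pos hε)
  refine ⟨min δ (ε / 2), lt_min hδ (half_pos hε), fun D hD hDc hxD i => ?_⟩
  have hDx : ∀ y ∈ D, dist x y < min δ (ε / 2) := fun y hy => by
    have hfin : hausdorffEDist ({x} : Set X) D ≠ ⊤ :=
      hausdorffEDist_ne_top_of_nonempty_of_bounded (singleton_nonempty x) hD
        Bornology.isBounded_singleton hDc.isBounded
    obtain ⟨_, rfl, h⟩ := exists_dist_lt_of_hausdorffDist_lt' hy hxD hfin
    exact h
  have hword : ∀ l : List (X → X), (∀ g ∈ l, g ∈ Φ) → ∀ y ∈ D,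
      dist (l.foldr (· ∘ ·) id x) (l.foldr (· ∘ ·) id y) ≤ ε / 2 := fun l hl y hy => by
    rcases eq_or_ne l [] with rfl | hne
    · exact ((hDx y hy).trans_le (min_le_right _ _)).le
    · exact (hδx y ((hDx y hy).trans_le (min_le_left _ _)) _ ⟨l, hne, hl, rfl⟩).le
  rw [← hausdorffDist_closure, closure_iterate_Hutch hΦcont, closure_iterate_Hutch hΦcont,
    hausdorffDist_closure]
  refine (hausdorffDist_le_of_mem_dist (half_pos hε).le ?_ ?_).trans_lt (half_lt_self hε)
  · rintro _ ⟨l, hl, hlΦ, _, rfl, rfl⟩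
    obtain ⟨y, hy⟩ := hD
    exact ⟨_, ⟨l, hl, hlΦ, y, hy, rfl⟩, hword l hlΦ y hy⟩
  · rintro _ ⟨l, hl, hlΦ, y, hy, rfl⟩
    exact ⟨_, ⟨l, hl, hlΦ, x, rfl, rfl⟩, by rw [dist_comm]; exact hword l hlΦ y hy⟩
end

section
/- Let X be a nonempty compact metric space and Φ = {φ_1,…,φ_ℓ} a finite family of continuous self-maps of X such that the IFS (X,Φ⁺) is forward minimal. Let φ ∈ Φ and let U be a nonempty open subset of X with φ(closure U) ⊆ U. Then there exists N ∈ ℕ such that for every x ∈ X and every n ≥ N there is a composition w of exactly n maps from Φ with w(x) ∈ U; equivalently, F^n({x}) ∩ U ≠ ∅ for all x ∈ X and all n ≥ N. -/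
open Metric Set Function Filter

/-- The points sent into `U` by some composition of exactly `n` members of `Φ`. -/
def hittingSet {X : Type*} (Φ : Set (X → X)) (U : Set X) (n : ℕ) : Set X :=
  {x | ∃ l : List (X → X), l.length = n ∧ (∀ g ∈ l, g ∈ Φ) ∧ (l.foldr (· ∘ ·) id) x ∈ U}

theorem foldr_comp_append_singleton {X : Type*} (l : List (X → X)) (g : X → X) :
    (l ++ [g]).foldr (· ∘ ·) id = l.foldr (· ∘ ·) id ∘ g := by
  induction l with
  | nil => rfl
  | cons f l ih => simp only [List.cons_append, List.foldr_cons, ih, Function.comp_assoc]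

theorem continuous_foldr_comp {X : Type*} [TopologicalSpace X] {l : List (X → X)}
    (hl : ∀ g ∈ l, Continuous g) : Continuous (l.foldr (· ∘ ·) id) := by
  induction l with
  | nil => exact continuous_id
  | cons f l ih =>
    exact (hl f List.mem_cons_self).comp (ih fun g hg => hl g (List.mem_cons_of_mem f hg))

theorem foldr_comp_mem_iterate_hutch {X : Type*} [TopologicalSpace X] {Φ : Set (X → X)}
    {l : List (X → X)} (hl : ∀ g ∈ l, g ∈ Φ) (x : X) :
    (l.foldr (· ∘ ·) id) x ∈ (Hutch Φ)^[l.length] {x} := by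
  induction l with
  | nil => rfl
  | cons f l ih =>
    rw [List.length_cons, Function.iterate_succ_apply']
    exact subset_closure (mem_biUnion (hl f List.mem_cons_self)
      (mem_image_of_mem f (ih fun g hg => hl g (List.mem_cons_of_mem f hg))))

theorem isOpen_hittingSet {X : Type*} [TopologicalSpace X] {Φ : Set (X → X)} {U : Set X}
    (hΦ : ∀ g ∈ Φ, Continuous g) (hU : IsOpen U) (n : ℕ) : IsOpen (hittingSet Φ U n) := by
  rw [isOpen_iff_mem_nhds]
  rintro x ⟨l, hn, hl, hx⟩
  filter_upwards [(hU.preimage (continuous_foldr_comp fun g hg => hΦ g (hl g hg))).mem_nhds hx]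
    with y hy
  exact ⟨l, hn, hl, hy⟩

theorem monotone_hittingSet {X : Type*} {Φ : Set (X → X)} {U : Set X} {φ : X → X}
    (hφ : φ ∈ Φ) (hU : MapsTo φ U U) : Monotone (hittingSet Φ U) := by
  refine monotone_nat_of_le_succ ?_
  rintro n x ⟨l, rfl, hl, hx⟩
  exact ⟨φ :: l, rfl, List.forall_mem_cons.2 ⟨hφ, hl⟩, hU hx⟩

theorem iUnion_hittingSet {X : Type*} [TopologicalSpace X] {Φ : Set (X → X)} {U : Set X}
    (hΦ : ∀ g ∈ Φ, Continuous g) (hmin : ForwardMinimal Φ) (hU : IsOpen U) (hne : U.Nonempty) :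
    ⋃ n, hittingSet Φ U n = univ := by
  by_contra hW
  have huniv := hmin (⋃ n, hittingSet Φ U n)ᶜ (nonempty_compl.2 hW)
    (isOpen_iUnion (isOpen_hittingSet hΦ hU)).isClosed_compl (by
      rintro g hg _ ⟨x, hx, rfl⟩ hgx
      obtain ⟨n, l, -, hl, hlx⟩ := mem_iUnion.1 hgx
      refine hx (mem_iUnion.2 ⟨(l ++ [g]).length, l ++ [g], rfl, ?_, ?_⟩)
      · simpa [or_imp, forall_and] using ⟨hl, hg⟩
      · rwa [foldr_comp_append_singleton])
  obtain ⟨u, hu⟩ := hne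
  have hu' : u ∈ (⋃ n, hittingSet Φ U n)ᶜ := huniv ▸ mem_univ u
  exact hu' (mem_iUnion.2 ⟨0, [], rfl, by simp, hu⟩)

/-- If the IFS `(X, Φ⁺)` on a nonempty compact metric space is forward minimal,
`φ ∈ Φ` and `U` is a nonempty open set with `φ(closure U) ⊆ U`, then there is `N` such that for
every `x ∈ X` and every `n ≥ N` some composition of exactly `n` maps from `Φ` sends `x` into `U`;
equivalently, `F^n({x}) ∩ U ≠ ∅` for all `x` and all `n ≥ N`. -/
theorem stmt6 {X : Type*} [MetricSpace X] [CompactSpace X] [Nonempty X]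
    (Φ : Set (X → X)) (hΦfin : Φ.Finite) (hΦne : Φ.Nonempty)
    (hΦcont : ∀ φ ∈ Φ, Continuous φ)
    (hmin : ForwardMinimal Φ)
    (φ : X → X) (hφ : φ ∈ Φ)
    (U : Set X) (hUopen : IsOpen U) (hUne : U.Nonempty)
    (hUinv : φ '' closure U ⊆ U) :
    ∃ N : ℕ, ∀ x : X, ∀ n ≥ N,
      (∃ l : List (X → X), l.length = n ∧ (∀ g ∈ l, g ∈ Φ) ∧
        (l.foldr (· ∘ ·) id) x ∈ U) ∧
      ((Hutch Φ)^[n] {x} ∩ U).Nonempty := by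
  have hmono : Monotone (hittingSet Φ U) :=
    monotone_hittingSet hφ fun x hx => hUinv (mem_image_of_mem φ (subset_closure hx))
  obtain ⟨N, hN⟩ := isCompact_univ.elim_directed_cover (hittingSet Φ U)
    (isOpen_hittingSet hΦcont hUopen) (iUnion_hittingSet hΦcont hmin hUopen hUne).ge
    hmono.directed_le
  refine ⟨N, fun x n hn => ?_⟩
  obtain ⟨l, rfl, hl, hx⟩ := hmono hn (hN (mem_univ x))
  exact ⟨⟨l, rfl, hl, hx⟩, _, foldr_comp_mem_iterate_hutch hl x, hx⟩
end

section
/- Let X be a nonempty connected compact metric space and Φ = {φ_1,…,φ_ℓ} a finite family of continuous self-maps of X such that the IFS (X,Φ⁺) is forward minimal and some φ ∈ Φ has an attracting fixed point p. Then for every y_0 ∈ X and every ε > 0 there exists N ∈ ℕ such that for all x ∈ X and all j ≥ N, F^j({x}) ∩ B(y_0, ε) ≠ ∅, where B(y_0, ε) is the open ball of radius ε about y_0. -/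
open Metric Set Function Filter

/-- `f` is a composition of exactly `n` members of `Φ`. -/
inductive IsWord {X : Type*} (Φ : Set (X → X)) : ℕ → (X → X) → Prop
  | id : IsWord Φ 0 id
  | comp {n : ℕ} {φ f : X → X} : φ ∈ Φ → IsWord Φ n f → IsWord Φ (n + 1) (φ ∘ f)

namespace IsWord

variable {X : Type*} {Φ : Set (X → X)} {m n : ℕ} {f g : X → X}

theorem trans (hf : IsWord Φ m f) (hg : IsWord Φ n g) : IsWord Φ (m + n) (f ∘ g) := by
  induction hf with
  | id => simpa using hg
  | comp hφ _ ih =>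
    rw [Nat.add_right_comm, Function.comp_assoc]
    exact .comp hφ ih

theorem iterate {φ : X → X} (hφ : φ ∈ Φ) (k : ℕ) : IsWord Φ k φ^[k] := by
  induction k with
  | zero => exact .id
  | succ k ih =>
    rw [Function.iterate_succ']
    exact .comp hφ ih

variable [TopologicalSpace X]

theorem continuous (hΦ : ∀ φ ∈ Φ, Continuous φ) (hf : IsWord Φ n f) : Continuous f := by
  induction hf with
  | id => exact continuous_id
  | comp hφ _ ih => exact (hΦ _ hφ).comp ih

theorem apply_mem_hutch_iterate (hf : IsWord Φ n f) (x : X) : f x ∈ (Hutch Φ)^[n] {x} := by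
  induction hf with
  | id => simp
  | comp hφ _ ih =>
    rw [Function.iterate_succ_apply']
    exact subset_closure (mem_biUnion hφ (mem_image_of_mem _ ih))

end IsWord

/-- In a forward minimal IFS every orbit meets every nonempty open set. -/
theorem ForwardMinimal.exists_isWord_apply_mem {X : Type*} [TopologicalSpace X] {Φ : Set (X → X)}
    (hmin : ForwardMinimal Φ) (hΦ : ∀ φ ∈ Φ, Continuous φ) (x : X) {W : Set X} (hW : IsOpen W)
    (hne : W.Nonempty) : ∃ n f, IsWord Φ n f ∧ f x ∈ W := by
  have huniv : closure {y | ∃ n f, IsWord Φ n f ∧ f x = y} = univ := by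
    refine hmin _ ⟨x, subset_closure ⟨0, id, .id, rfl⟩⟩ isClosed_closure fun φ hφ => ?_
    refine (image_closure_subset_closure_image (hΦ φ hφ)).trans (closure_mono ?_)
    rintro _ ⟨_, ⟨n, f, hf, rfl⟩, rfl⟩
    exact ⟨n + 1, φ ∘ f, .comp hφ hf, rfl⟩
  obtain ⟨w, hw⟩ := hne
  obtain ⟨_, hy, n, f, hf, rfl⟩ := mem_closure_iff.1 (huniv ▸ mem_univ w) W hW hw
  exact ⟨n, f, hf, hy⟩

/-- On a compact space the number of maps needed to enter a given nonempty open set is bounded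
uniformly in the starting point. -/
theorem ForwardMinimal.exists_bound_isWord_apply_mem {X : Type*} [TopologicalSpace X]
    [CompactSpace X] {Φ : Set (X → X)} (hmin : ForwardMinimal Φ) (hΦ : ∀ φ ∈ Φ, Continuous φ)
    {W : Set X} (hW : IsOpen W) (hne : W.Nonempty) :
    ∃ N, ∀ x, ∃ n ≤ N, ∃ f, IsWord Φ n f ∧ f x ∈ W := by
  choose n f hf hfW using fun x => hmin.exists_isWord_apply_mem hΦ x hW hne
  obtain ⟨t, ht⟩ := isCompact_univ.elim_finite_subcover (fun z => f z ⁻¹' W)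
    (fun z => hW.preimage ((hf z).continuous hΦ)) fun x _ => mem_iUnion.2 ⟨x, hfW x⟩
  refine ⟨t.sup n, fun x => ?_⟩
  obtain ⟨z, hz, hx⟩ := mem_iUnion₂.1 (ht (mem_univ x))
  exact ⟨n z, Finset.le_sup hz, f z, hf z, hx⟩

/-- Under iteration the trapping neighbourhood of an attracting fixed point eventually enters
every neighbourhood of that point. -/
theorem AttractingFixedPoint.exists_eventually_image_subset {X : Type*} [TopologicalSpace X]
    [CompactSpace X] [T2Space X] {φ : X → X} {p : X} (hp : AttractingFixedPoint φ p)
    (hφ : Continuous φ) : ∃ U : Set X, IsOpen U ∧ p ∈ U ∧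
      ∀ V ∈ nhds p, ∃ k, ∀ n ≥ k, φ^[n] '' U ⊆ V := by
  obtain ⟨-, U, hU, hpU, hsub, hInter⟩ := hp
  refine ⟨U, hU, hpU, fun V hV => ?_⟩
  have hsucc (n : ℕ) : φ^[n + 1] '' closure U ⊆ φ^[n] '' U := by
    rw [Function.iterate_succ, image_comp]
    exact image_mono hsub
  have hanti : Antitone fun n => φ^[n] '' closure U :=
    antitone_nat_of_succ_le fun n => (hsucc n).trans (image_mono subset_closure)
  obtain ⟨k, hk⟩ := exists_subset_nhds_of_compactSpace (U := V) hanti.directed_ge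
    (fun n => (isClosed_closure.isCompact.image (hφ.iterate n)).isClosed) fun x hx => by
      have hxp : x ∈ ⋂ n : ℕ, φ^[n] '' U := mem_iInter.2 fun n => hsucc n (mem_iInter.1 hx (n + 1))
      rw [hInter, mem_singleton_iff] at hxp
      exact hxp ▸ hV
  exact ⟨k, fun n hn => (image_mono subset_closure).trans ((hanti hn).trans hk)⟩

/-- If `X` is a nonempty connected compact metric space, the IFS `(X, Φ⁺)` is
forward minimal and some `φ ∈ Φ` has an attracting fixed point `p`, then for every `y₀ ∈ X` and
`ε > 0` there is `N` with `F^j({x}) ∩ B(y₀, ε) ≠ ∅` for all `x ∈ X` and all `j ≥ N`. -/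
theorem stmt7 {X : Type*} [MetricSpace X] [CompactSpace X] [ConnectedSpace X] [Nonempty X]
    (Φ : Set (X → X)) (hΦfin : Φ.Finite) (hΦne : Φ.Nonempty)
    (hΦcont : ∀ φ ∈ Φ, Continuous φ)
    (hmin : ForwardMinimal Φ)
    (φ : X → X) (hφ : φ ∈ Φ) (p : X) (hp : AttractingFixedPoint φ p) :
    ∀ y₀ : X, ∀ ε > (0 : ℝ), ∃ N : ℕ, ∀ x : X, ∀ j ≥ N,
      ((Hutch Φ)^[j] {x} ∩ Metric.ball y₀ ε).Nonempty := by
  intro y₀ ε hε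
  obtain ⟨m, g, hg, hgp⟩ := hmin.exists_isWord_apply_mem hΦcont p isOpen_ball ⟨y₀, mem_ball_self hε⟩
  obtain ⟨U, hU, hpU, hUV⟩ := hp.exists_eventually_image_subset (hΦcont φ hφ)
  obtain ⟨k, hk⟩ := hUV _ ((hg.continuous hΦcont).continuousAt (isOpen_ball.mem_nhds hgp))
  obtain ⟨N, hN⟩ := hmin.exists_bound_isWord_apply_mem hΦcont hU ⟨p, hpU⟩
  refine ⟨m + (k + N), fun x j hj => ?_⟩
  obtain ⟨n, hn, f, hf, hfU⟩ := hN x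
  obtain ⟨i, rfl⟩ : ∃ i, j = m + (i + n) := ⟨j - m - n, by omega⟩
  exact ⟨_, (hg.trans ((IsWord.iterate hφ i).trans hf)).apply_mem_hutch_iterate x,
    hk i (by omega) (mem_image_of_mem _ hfU)⟩
end

section
/- Let X be a nonempty connected compact metric space and Φ = {φ_1,…,φ_ℓ} a finite family of continuous self-maps of X such that the IFS (X,Φ⁺) is forward minimal and some φ ∈ Φ has an attracting fixed point p. Then the convergence of iterated Hutchinson images of singletons to X is uniform: for every ε > 0 there exists N ∈ ℕ such that d_H(F^j({x}), X) < ε for every x ∈ X and every j ≥ N. -/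
open Metric Set Function Filter

/-- The compositions of exactly `n` members of `Φ`. -/
def Words {X : Type*} (Φ : Set (X → X)) : ℕ → Set (X → X)
  | 0 => {id}
  | n + 1 => {f | ∃ φ ∈ Φ, ∃ g ∈ Words Φ n, f = φ ∘ g}

namespace Words

variable {X : Type*} {Φ : Set (X → X)}

theorem comp {m n : ℕ} {f g : X → X} (hf : f ∈ Words Φ m) (hg : g ∈ Words Φ n) :
    f ∘ g ∈ Words Φ (m + n) := by
  induction m generalizing f with
  | zero =>
    obtain rfl : f = id := hf
    simpa using hg
  | succ m ih =>
    obtain ⟨φ, hφ, f, hf, rfl⟩ := hf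
    rw [Nat.succ_add]
    exact ⟨φ, hφ, f ∘ g, ih hf, rfl⟩

theorem iterate {φ : X → X} (hφ : φ ∈ Φ) (n : ℕ) : φ^[n] ∈ Words Φ n := by
  induction n with
  | zero => rfl
  | succ n ih => exact ⟨φ, hφ, _, ih, iterate_succ' φ n⟩

theorem continuous [TopologicalSpace X] (hΦ : ∀ φ ∈ Φ, Continuous φ) {n : ℕ} {f : X → X}
    (hf : f ∈ Words Φ n) : Continuous f := by
  induction n generalizing f with
  | zero =>
    obtain rfl : f = id := hf
    exact continuous_id
  | succ n ih =>
    obtain ⟨φ, hφ, f, hf, rfl⟩ := hf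
    exact (hΦ φ hφ).comp (ih hf)

theorem mem_iterate_hutch [TopologicalSpace X] {n : ℕ} {f : X → X} (hf : f ∈ Words Φ n) (x : X) :
    f x ∈ (Hutch Φ)^[n] {x} := by
  induction n generalizing f with
  | zero =>
    obtain rfl : f = id := hf
    rfl
  | succ n ih =>
    obtain ⟨φ, hφ, f, hf, rfl⟩ := hf
    rw [iterate_succ_apply']
    exact subset_closure (mem_biUnion hφ (mem_image_of_mem φ (ih hf)))

/-- In a forward minimal system every orbit is dense. -/
theorem exists_mem_open [TopologicalSpace X] (hΦ : ∀ φ ∈ Φ, Continuous φ)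
    (hmin : ForwardMinimal Φ) (x : X) {V : Set X} (hV : IsOpen V) (hVne : V.Nonempty) :
    ∃ n, ∃ f ∈ Words Φ n, f x ∈ V := by
  have hA : closure {y | ∃ n, ∃ f ∈ Words Φ n, f x = y} = univ := by
    refine hmin _ ⟨x, subset_closure ⟨0, id, rfl, rfl⟩⟩ isClosed_closure fun φ hφ => ?_
    refine (image_closure_subset_closure_image (hΦ φ hφ)).trans (closure_mono ?_)
    rintro _ ⟨_, ⟨n, f, hf, rfl⟩, rfl⟩
    exact ⟨n + 1, φ ∘ f, ⟨φ, hφ, f, hf, rfl⟩, rfl⟩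
  obtain ⟨y, hy⟩ := hVne
  obtain ⟨_, hzV, n, f, hf, rfl⟩ := mem_closure_iff.1 (hA ▸ mem_univ y) V hV hy
  exact ⟨n, f, hf, hzV⟩

/-- An open set mapped into itself by a member of a forward minimal system is reached from every
point at all sufficiently large times, uniformly in the point. -/
theorem exists_forall_ge_mem_open [TopologicalSpace X] [CompactSpace X]
    (hΦ : ∀ φ ∈ Φ, Continuous φ) (hmin : ForwardMinimal Φ) {φ : X → X} (hφ : φ ∈ Φ)
    {U : Set X} (hU : IsOpen U) (hUne : U.Nonempty) (hφU : MapsTo φ U U) :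
    ∃ N, ∀ j ≥ N, ∀ x, ∃ f ∈ Words Φ j, f x ∈ U := by
  choose n f hf hfU using fun x => exists_mem_open hΦ hmin x hU hUne
  obtain ⟨t, ht⟩ := CompactSpace.elim_nhds_subcover (fun x => f x ⁻¹' U)
    fun x => (hU.preimage (continuous hΦ (hf x))).mem_nhds (hfU x)
  refine ⟨t.sup n, fun j hj x => ?_⟩
  have hx : x ∈ ⋃ y ∈ t, f y ⁻¹' U := by rw [ht]; trivial
  obtain ⟨y, hy, hxy⟩ := mem_iUnion₂.1 hx
  refine ⟨φ^[j - n y] ∘ f y, ?_, hφU.iterate _ hxy⟩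
  have hw := comp (iterate hφ (j - n y)) (hf y)
  rwa [Nat.sub_add_cancel ((Finset.le_sup hy).trans hj)] at hw

end Words

/-- The iterated images of a trapping region of a fixed point enter every neighbourhood of it. -/
theorem exists_iterate_mapsTo_of_iInter_eq_singleton {X : Type*} [TopologicalSpace X] [T2Space X]
    [CompactSpace X] {φ : X → X} (hφ : Continuous φ) {p : X} {U V : Set X}
    (hU : φ '' closure U ⊆ U) (hp : (⋂ n : ℕ, φ^[n] '' U) = {p}) (hV : IsOpen V) (hpV : p ∈ V) :
    ∃ k, MapsTo φ^[k] U V := by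
  have hstep (n : ℕ) : φ^[n + 1] '' closure U ⊆ φ^[n] '' U := by
    rw [iterate_succ, image_comp]
    exact image_mono hU
  have hanti : Antitone fun n : ℕ => φ^[n] '' closure U :=
    antitone_nat_of_succ_le fun n => (hstep n).trans (image_mono subset_closure)
  have hcomp (n : ℕ) : IsCompact (φ^[n] '' closure U) :=
    isClosed_closure.isCompact.image (hφ.iterate n)
  have hsub : (⋂ n : ℕ, φ^[n] '' closure U) ⊆ V := by
    intro y hy
    have hyp : y ∈ ⋂ n : ℕ, φ^[n] '' U :=
      mem_iInter.2 fun n => hstep n (mem_iInter.1 hy (n + 1))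
    rw [hp, mem_singleton_iff] at hyp
    exact hyp ▸ hpV
  obtain ⟨k, hk⟩ := exists_subset_nhds_of_isCompact hanti.directed_ge hcomp
    fun y hy => hV.mem_nhds (hsub hy)
  exact ⟨k, fun y hy => hk (mem_image_of_mem _ (subset_closure hy))⟩

/-- If `X` is a nonempty connected compact metric space, the IFS `(X, Φ⁺)` is
forward minimal and some `φ ∈ Φ` has an attracting fixed point `p`, then the convergence of
iterated Hutchinson images of singletons to `X` is uniform: for every `ε > 0` there is `N` with
`d_H(F^j({x}), X) < ε` for every `x ∈ X` and every `j ≥ N`. -/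
theorem stmt8 {X : Type*} [MetricSpace X] [CompactSpace X] [ConnectedSpace X] [Nonempty X]
    (Φ : Set (X → X)) (hΦfin : Φ.Finite) (hΦne : Φ.Nonempty)
    (hΦcont : ∀ φ ∈ Φ, Continuous φ)
    (hmin : ForwardMinimal Φ)
    (φ : X → X) (hφ : φ ∈ Φ) (p : X) (hp : AttractingFixedPoint φ p) :
    ∀ ε > (0 : ℝ), ∃ N : ℕ, ∀ x : X, ∀ j ≥ N,
      hausdorffDist ((Hutch Φ)^[j] {x}) (Set.univ : Set X) < ε := by
  intro ε hε
  obtain ⟨hfix, U, hUo, hpU, hφU, hinter⟩ := hp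
  have hδ : 0 < ε / 3 := by positivity
  choose n f hf hfp using fun y : X =>
    Words.exists_mem_open hΦcont hmin p (isOpen_ball (x := y) (ε := ε / 3)) (nonempty_ball.2 hδ)
  obtain ⟨t, ht⟩ := CompactSpace.elim_nhds_subcover (fun y : X => ball y (ε / 3))
    fun y => ball_mem_nhds y hδ
  have hg (y : X) (hy : y ∈ t) :
      ∃ g ∈ Words Φ (t.sup n), g p ∈ ball y (ε / 3) := by
    refine ⟨f y ∘ φ^[t.sup n - n y], ?_, ?_⟩
    · have hw := Words.comp (hf y) (Words.iterate hφ (t.sup n - n y))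
      rwa [Nat.add_sub_cancel' (Finset.le_sup hy)] at hw
    · rw [comp_apply, iterate_fixed hfix]
      exact hfp y
  choose! g hg hgp using hg
  have hVo : IsOpen (⋂ y ∈ t, g y ⁻¹' ball y (ε / 3)) :=
    isOpen_biInter_finset fun y hy => isOpen_ball.preimage (Words.continuous hΦcont (hg y hy))
  obtain ⟨k, hk⟩ := exists_iterate_mapsTo_of_iInter_eq_singleton (hΦcont φ hφ) hφU hinter hVo
    (mem_iInter₂.2 hgp)
  obtain ⟨N, hN⟩ := Words.exists_forall_ge_mem_open hΦcont hmin hφ hUo ⟨p, hpU⟩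
    fun y hy => hφU (mem_image_of_mem φ (subset_closure hy))
  refine ⟨t.sup n + (k + N), fun x j hj => ?_⟩
  obtain ⟨i, rfl⟩ := Nat.exists_eq_add_of_le hj
  obtain ⟨h, hh, hxU⟩ := hN (N + i) (Nat.le_add_right N i) x
  refine (hausdorffDist_le_of_mem_dist (r := 2 * (ε / 3)) (by positivity)
    (fun y _ => ⟨y, mem_univ y, by rw [dist_self]; positivity⟩) fun z _ => ?_).trans_lt
    (by linarith)
  have hz : z ∈ ⋃ y ∈ t, ball y (ε / 3) := by rw [ht]; trivial
  obtain ⟨y, hy, hzy⟩ := mem_iUnion₂.1 hz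
  have hw := Words.comp (hg y hy) (Words.comp (Words.iterate hφ k) hh)
  rw [← add_assoc k, ← add_assoc (t.sup n)] at hw
  refine ⟨_, Words.mem_iterate_hutch hw x, ?_⟩
  have hxy : dist (g y (φ^[k] (h x))) y < ε / 3 := mem_iInter₂.1 (hk hxU) y hy
  have hzy' : dist z y < ε / 3 := hzy
  simp only [comp_apply]
  linarith [dist_triangle_right z (g y (φ^[k] (h x))) y]
end

section
/- Let X be a nonempty compact metric space and Φ = {φ_1,…,φ_ℓ} a finite family of continuous self-maps of X. Suppose X is an attractor of the IFS (X,Φ⁺) and the system (K(X), F) is equicontinuous. Then the convergence to X is uniform over K(X): for every ε > 0 there exists N ∈ ℕ such that d_H(F^i(Y), X) < ε for every Y ∈ K(X) and every i ≥ N. -/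
open Metric Set Function Filter

theorem Hutch.nonempty {X : Type*} [TopologicalSpace X] {Φ : Set (X → X)} (hΦ : Φ.Nonempty)
    {Y : Set X} (hY : Y.Nonempty) : (Hutch Φ Y).Nonempty := by
  obtain ⟨φ, hφ⟩ := hΦ
  obtain ⟨y, hy⟩ := hY
  exact ⟨φ y, subset_closure (mem_biUnion hφ (mem_image_of_mem φ hy))⟩

theorem Hutch.iterate_nonempty {X : Type*} [TopologicalSpace X] {Φ : Set (X → X)}
    (hΦ : Φ.Nonempty) {Y : Set X} (hY : Y.Nonempty) (i : ℕ) : ((Hutch Φ)^[i] Y).Nonempty := by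
  induction i with
  | zero => exact hY
  | succ i ih =>
    rw [iterate_succ_apply']
    exact Hutch.nonempty hΦ ih

theorem hausdorffDist_triangle_of_compactSpace {X : Type*} [PseudoMetricSpace X] [CompactSpace X]
    {s t u : Set X} (hs : s.Nonempty) (ht : t.Nonempty) :
    hausdorffDist s u ≤ hausdorffDist s t + hausdorffDist t u :=
  hausdorffDist_triangle <| hausdorffEDist_ne_top_of_nonempty_of_bounded hs ht
    (Bornology.IsBounded.all s) (Bornology.IsBounded.all t)

/-- If `X` (nonempty compact) is an attractor of the IFS `(X, Φ⁺)` and the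
system `(K(X), F)` is equicontinuous, then the convergence to `X` is uniform over `K(X)`:
for every `ε > 0` there is `N` with `d_H(F^i(Y), X) < ε` for every nonempty compact `Y` and
every `i ≥ N`. -/
theorem stmt10 {X : Type*} [MetricSpace X] [CompactSpace X] [Nonempty X]
    (Φ : Set (X → X)) (hΦfin : Φ.Finite) (hΦne : Φ.Nonempty)
    (hΦcont : ∀ φ ∈ Φ, Continuous φ)
    (hattr : ∀ B : Set X, B.Nonempty → IsCompact B →
      Filter.Tendsto (fun j : ℕ => hausdorffDist ((Hutch Φ)^[j] B) (Set.univ : Set X))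
        Filter.atTop (nhds 0))
    (hequi : ∀ D : Set X, D.Nonempty → IsCompact D → ∀ ε > (0 : ℝ), ∃ δ > (0 : ℝ),
      ∀ D' : Set X, D'.Nonempty → IsCompact D' → hausdorffDist D D' < δ →
        ∀ i : ℕ, hausdorffDist ((Hutch Φ)^[i] D) ((Hutch Φ)^[i] D') < ε) :
    ∀ ε > (0 : ℝ), ∃ N : ℕ, ∀ Y : Set X, Y.Nonempty → IsCompact Y →
      ∀ i ≥ N, hausdorffDist ((Hutch Φ)^[i] Y) (Set.univ : Set X) < ε := by
  intro ε hε
  have hlocal : ∀ D : TopologicalSpace.NonemptyCompacts X, ∃ N : ℕ, ∃ δ > (0 : ℝ),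
      ∀ Y : TopologicalSpace.NonemptyCompacts X, dist Y D < δ →
        ∀ i ≥ N, hausdorffDist ((Hutch Φ)^[i] (Y : Set X)) (Set.univ : Set X) < ε := by
    intro D
    obtain ⟨δ, hδ, hδD⟩ := hequi D D.nonempty D.isCompact (ε / 2) (half_pos hε)
    obtain ⟨N, hN⟩ := eventually_atTop.1
      ((hattr D D.nonempty D.isCompact).eventually (gt_mem_nhds (half_pos hε)))
    refine ⟨N, δ, hδ, fun Y hY i hi => ?_⟩
    have hDY := hδD Y Y.nonempty Y.isCompact
      (by rwa [← Metric.NonemptyCompacts.dist_eq, dist_comm]) i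
    rw [hausdorffDist_comm] at hDY
    have htri := hausdorffDist_triangle_of_compactSpace (u := (Set.univ : Set X))
      (Hutch.iterate_nonempty hΦne Y.nonempty i) (Hutch.iterate_nonempty hΦne D.nonempty i)
    linarith [hN i hi]
  choose N δ hδ hNδ using hlocal
  obtain ⟨t, -, ht⟩ := isCompact_univ.elim_nhds_subcover (fun D => ball D (δ D))
    (fun D _ => ball_mem_nhds D (hδ D))
  refine ⟨t.sup N, fun Y hYne hY i hi => ?_⟩
  let K : TopologicalSpace.NonemptyCompacts X := ⟨⟨Y, hY⟩, hYne⟩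
  obtain ⟨D, hDt, hD⟩ := mem_iUnion₂.1 (ht (mem_univ K))
  exact hNδ D K hD i ((Finset.le_sup hDt).trans hi)
end
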